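/- (Lemma 1, strict inequality form) Fix an integer L ≥ 1, a real P > 0 and a channel vector h ∈ ℝ^L. Let a₁ ∈ ℤ^L be a nonzero integer coefficient vector with R(h, a₁) > 0, and let λ ∈ ℤ with |λ| > 1. Then R(h, λ·a₁) < R(h, a₁); that is, scaling an equation coefficient vector by an integer of absolute value greater than one strictly decreases a positive computation rate. -/

import Mathlib

open Finset

/-- The quadratic form `q(a) = ‖a‖² − P·(hᵀa)²/(1 + P·‖h‖²)`. -/
noncomputable def q (L : ℕ) (P : ℝ) (h : Fin L → ℝ) (a : Fin L → ℝ) : ℝ :=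
  (∑ i, a i ^ 2) - P * (∑ i, h i * a i) ^ 2 / (1 + P * ∑ i, h i ^ 2)

/-- The computation rate `R(h,a) = (1/2)·log₂⁺(q(a)⁻¹)` of an integer coefficient vector. -/
noncomputable def rate (L : ℕ) (P : ℝ) (h : Fin L → ℝ) (a : Fin L → ℤ) : ℝ :=
  (1 / 2) * max (Real.logb 2 (q L P h (fun i => (a i : ℝ)))⁻¹) 0

theorem q_smul (L : ℕ) (P : ℝ) (h a : Fin L → ℝ) (c : ℝ) :
    q L P h (fun i => c * a i) = c ^ 2 * q L P h a := by
  have hinner : ∑ i, h i * (c * a i) = c * ∑ i, h i * a i := by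
    rw [mul_sum]
    exact sum_congr rfl fun i _ => by ring
  simp only [q, hinner, mul_pow, ← mul_sum]
  ring

theorem q_pos (L : ℕ) {P : ℝ} (hP : 0 ≤ P) (h : Fin L → ℝ) {a : Fin L → ℝ} (ha : a ≠ 0) :
    0 < q L P h a := by
  have hnorm : 0 < ∑ i, a i ^ 2 := by
    obtain ⟨j, hj⟩ := Function.ne_iff.mp ha
    exact sum_pos' (fun i _ => sq_nonneg _) ⟨j, mem_univ j, sq_pos_of_ne_zero hj⟩
  have hcs := mul_le_mul_of_nonneg_left (sum_mul_sq_le_sq_mul_sq univ h a) hP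
  have hden : 0 < 1 + P * ∑ i, h i ^ 2 := by positivity
  rw [q, sub_pos, div_lt_iff₀ hden]
  linarith

theorem rate_of_int_smul_lt
    (L : ℕ) (hL : 1 ≤ L) (P : ℝ) (hP : 0 < P) (h : Fin L → ℝ)
    (a₁ : Fin L → ℤ) (ha₁ : a₁ ≠ 0) (hpos : 0 < rate L P h a₁)
    (lam : ℤ) (hlam : 1 < |lam|) :
    rate L P h (fun i => lam * a₁ i) < rate L P h a₁ := by
  have ha : (fun i => (a₁ i : ℝ)) ≠ 0 := fun h0 =>
    ha₁ (funext fun i => by simpa using congrFun h0 i)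
  have hq := q_pos L hP.le h ha
  have hlam_sq : (1 : ℝ) < (lam : ℝ) ^ 2 := by
    exact_mod_cast (one_lt_sq_iff_one_lt_abs lam).mpr hlam
  have hlog : Real.logb 2 (q L P h fun i => ((lam * a₁ i : ℤ) : ℝ))⁻¹ <
      Real.logb 2 (q L P h fun i => (a₁ i : ℝ))⁻¹ := by
    simp only [Int.cast_mul]
    rw [q_smul L P h (fun i => (a₁ i : ℝ))]
    refine Real.logb_lt_logb one_lt_two (by positivity) ?_
    exact inv_strictAnti₀ hq (lt_mul_of_one_lt_left hq hlam_sq)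
  have hlog_pos : 0 < Real.logb 2 (q L P h fun i => (a₁ i : ℝ))⁻¹ := by
    rw [rate] at hpos
    exact (lt_max_iff.mp (pos_of_mul_pos_right hpos (by norm_num))).resolve_right (lt_irrefl 0)
  exact mul_lt_mul_of_pos_left (lt_max_of_lt_left (max_lt hlog hlog_pos)) (by norm_num)
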